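/- Consider the idealized Slim-subsketch model over a finite item type ι, with the hash functions h chosen uniformly at random from the finite set of all functions Fin d → ι → Fin w. Let L be a nonempty finite list of items with N = length of L, and let e be any item. Then the probability (over the random choice of h) that the query for e after processing L is at least f_L(e) + exp(1) · N / w is at most exp(−d), where exp denotes the real exponential function. (The paper's over-estimation bound Pr[f̂_e ≥ f_e + εN] ≤ δ with ε = exp(1)/w and δ = exp(−d), obtained by Markov's inequality in each of the d independent arrays.) -/

import Mathlib

/-- One insertion step of the idealized Slim-subsketch: an occurrence of item `e`
arrives, and `c` is the number of occurrences of `e` in the stream so far,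
including this one. Letting `m` be the minimum over `i : Fin d` of `S i (h i e)`,
every counter `S i (h i e)` with `S i (h i e) = m` and `m < c` is incremented by 1,
and all other counters are unchanged. -/
def slimStep {ι : Type} {d w : ℕ} [NeZero d] (h : Fin d → ι → Fin w)
    (S : Fin d → Fin w → ℕ) (e : ι) (c : ℕ) : Fin d → Fin w → ℕ :=
  let m := Finset.univ.inf' Finset.univ_nonempty (fun i => S i (h i e))
  fun i j => if j = h i e ∧ S i (h i e) = m ∧ m < c then S i j + 1 else S i j

/-- Process a list of items left to right, where `cnt e` records the number of
occurrences of each item `e` seen so far. -/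
def slimProcessAux {ι : Type} [DecidableEq ι] {d w : ℕ} [NeZero d]
    (h : Fin d → ι → Fin w) :
    List ι → (ι → ℕ) → (Fin d → Fin w → ℕ) → (Fin d → Fin w → ℕ)
  | [], _, S => S
  | e :: L, cnt, S =>
      slimProcessAux h L (Function.update cnt e (cnt e + 1))
        (slimStep h S e (cnt e + 1))

/-- The state of the idealized Slim-subsketch after processing the stream `L`
starting from the all-zero state. -/
def slimSketch {ι : Type} [DecidableEq ι] {d w : ℕ} [NeZero d]
    (h : Fin d → ι → Fin w) (L : List ι) : Fin d → Fin w → ℕ :=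
  slimProcessAux h L (fun _ => 0) (fun _ _ => 0)

theorem slimStep_le {ι : Type} {d w : ℕ} [NeZero d] (h : Fin d → ι → Fin w)
    (S : Fin d → Fin w → ℕ) (e : ι) (c : ℕ) (i : Fin d) (j : Fin w) :
    slimStep h S e c i j ≤ S i j + if h i e = j then 1 else 0 := by
  unfold slimStep
  split_ifs with h1 h2 h2
  · omega
  · exact absurd h1.1.symm h2
  · omega
  · omega

theorem slimProcessAux_le {ι : Type} [DecidableEq ι] {d w : ℕ} [NeZero d]
    (h : Fin d → ι → Fin w) (i : Fin d) (j : Fin w) (L : List ι) :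
    ∀ (cnt : ι → ℕ) (S : Fin d → Fin w → ℕ),
      slimProcessAux h L cnt S i j ≤ S i j + L.countP (fun x => h i x = j) := by
  induction L with
  | nil => intro cnt S; simp [slimProcessAux]
  | cons a L ih =>
    intro cnt S
    rw [slimProcessAux, List.countP_cons]
    have h1 := ih (Function.update cnt a (cnt a + 1)) (slimStep h S a (cnt a + 1))
    have h2 := slimStep_le h S a (cnt a + 1) i j
    simp only [decide_eq_true_eq]
    omega

/-- Number of stream positions holding an item other than `e` colliding with `e`. -/
def collNum {ι : Type} [DecidableEq ι] {w : ℕ} (L : List ι) (e : ι) (g : ι → Fin w) : ℕ :=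
  L.countP (fun x => x ≠ e ∧ g x = g e)

theorem countP_le_collNum {ι : Type} [DecidableEq ι] {w : ℕ} (L : List ι) (e : ι)
    (g : ι → Fin w) :
    L.countP (fun x => g x = g e) ≤ L.count e + collNum L e g := by
  unfold collNum
  induction L with
  | nil => simp
  | cons a L ih =>
    rw [List.countP_cons, List.countP_cons, List.count_cons]
    by_cases hae : a = e
    · subst hae; simp at ih ⊢; omega
    · by_cases hg : g a = g e <;> simp [hae, hg] at ih ⊢ <;> omega

theorem card_coll {ι : Type} [Fintype ι] [DecidableEq ι] {w : ℕ} (x e : ι) (hx : x ≠ e) :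
    (Finset.univ.filter (fun g : ι → Fin w => g x = g e)).card * w
      ≤ Fintype.card (ι → Fin w) := by
  have hw : (Finset.univ.filter (fun g : ι → Fin w => g x = g e)).card * w
      = ((Finset.univ.filter (fun g : ι → Fin w => g x = g e)) ×ˢ
        (Finset.univ : Finset (Fin w))).card := by
    rw [Finset.card_product, Finset.card_univ, Fintype.card_fin]
  rw [hw, ← Finset.card_univ]
  refine Finset.card_le_card_of_injOn (fun p => Function.update p.1 x p.2)
    (fun _ _ => Finset.mem_coe.2 (Finset.mem_univ _)) ?_
  rintro ⟨g, c⟩ hg ⟨g2, c2⟩ hg2 heq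
  simp only [Finset.coe_product, Set.mem_prod, Finset.mem_coe, Finset.mem_filter,
    Finset.mem_univ, true_and, and_true] at hg hg2
  dsimp only at heq
  have hne : ∀ y, y ≠ x → g y = g2 y := by
    intro y hy
    have := congrFun heq y
    simpa [Function.update_of_ne hy] using this
  have hc : c = c2 := by simpa using congrFun heq x
  have : g = g2 := by
    funext y
    by_cases hy : y = x
    · subst hy; rw [hg, hg2, hne e hx.symm]
    · exact hne y hy
  rw [this, hc]

theorem sum_collNum {ι : Type} [Fintype ι] [DecidableEq ι] {w : ℕ} (L : List ι) (e : ι) :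
    (∑ g : ι → Fin w, collNum L e g) * w ≤ L.length * Fintype.card (ι → Fin w) := by
  induction L with
  | nil => simp [collNum]
  | cons a L ih =>
    have h1 : ∀ g : ι → Fin w, collNum (a :: L) e g
        = collNum L e g + if a ≠ e ∧ g a = g e then 1 else 0 := by
      intro g
      simp only [collNum, List.countP_cons, decide_eq_true_eq]
    simp only [h1, Finset.sum_add_distrib, List.length_cons, add_mul, one_mul]
    refine Nat.add_le_add ih ?_
    by_cases hae : a = e
    · simp [hae]
    · have := card_coll (w := w) a e hae
      simpa [hae] using this

theorem card_bad {ι : Type} [Fintype ι] [DecidableEq ι] {w : ℕ} [NeZero w] (L : List ι)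
    (hL : L ≠ []) (e : ι) (A : Finset (ι → Fin w))
    (hA : ∀ g ∈ A, Real.exp 1 * (L.length : ℝ) / (w : ℝ) ≤ collNum L e g) :
    (A.card : ℝ) ≤ Real.exp (-1) * (Fintype.card (ι → Fin w) : ℝ) := by
  have hw : (0 : ℝ) < w := by exact_mod_cast Nat.pos_of_ne_zero (NeZero.ne w)
  have hN : (0 : ℝ) < L.length := by exact_mod_cast List.length_pos_iff.2 hL
  have h1 : (A.card : ℝ) * (Real.exp 1 * (L.length : ℝ) / (w : ℝ))
      ≤ ∑ g : ι → Fin w, (collNum L e g : ℝ) := by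
    calc _ ≤ ∑ g ∈ A, (collNum L e g : ℝ) := by
          have := Finset.card_nsmul_le_sum A (fun g => (collNum L e g : ℝ)) _ hA
          simpa [nsmul_eq_mul] using this
      _ ≤ _ := Finset.sum_le_sum_of_subset_of_nonneg (Finset.subset_univ _)
          (fun _ _ _ => Nat.cast_nonneg _)
  have h2 : (∑ g : ι → Fin w, (collNum L e g : ℝ)) * w
      ≤ L.length * (Fintype.card (ι → Fin w) : ℝ) := by
    exact_mod_cast sum_collNum (w := w) L e
  have h3 := (mul_le_mul_of_nonneg_right h1 hw.le).trans h2
  have h4 : (A.card : ℝ) * (Real.exp 1 * (L.length : ℝ) / (w : ℝ)) * w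
      = L.length * (A.card * Real.exp 1) := by
    field_simp
  rw [h4] at h3
  have h5 := le_of_mul_le_mul_left h3 hN
  rw [Real.exp_neg, inv_mul_eq_div, le_div_iff₀ (Real.exp_pos 1)]
  exact h5

/-- The paper's over-estimation bound with `ε = exp(1)/w` and `δ = exp(−d)`:
for the idealized Slim-subsketch over a finite item type with a uniformly random
family of hash functions `h : Fin d → ι → Fin w`, for any nonempty stream `L`
of length `N` and any item `e`, the probability that the query for `e` is at
least `f_L(e) + exp(1)·N/w` is at most `exp(−d)`. -/
theorem slimSketch_overestimation_bound {ι : Type} [Fintype ι] [DecidableEq ι]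
    (d w : ℕ) [NeZero d] [NeZero w] (L : List ι) (hL : L ≠ []) (e : ι) :
    (PMF.uniformOfFintype (Fin d → ι → Fin w)).toMeasure
        {h : Fin d → ι → Fin w |
          (L.count e : ℝ) + Real.exp 1 * (L.length : ℝ) / (w : ℝ)
            ≤ (Finset.univ.inf' Finset.univ_nonempty
                (fun i : Fin d => slimSketch h L i (h i e)) : ℝ)}
      ≤ ENNReal.ofReal (Real.exp (-(d : ℝ))) := by
  classical
  set A : Finset (ι → Fin w) := Finset.univ.filter
    (fun g => Real.exp 1 * (L.length : ℝ) / (w : ℝ) ≤ collNum L e g) with hAdef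
  have hA := card_bad L hL e A (fun g hg => (Finset.mem_filter.1 hg).2)
  refine (MeasureTheory.measure_mono
    (t := ((Fintype.piFinset (fun _ : Fin d => A) : Finset _) : Set (Fin d → ι → Fin w))) ?_).trans ?_
  · intro h hh
    rw [Set.mem_ofPred_eq] at hh
    rw [Finset.mem_coe, Fintype.mem_piFinset]
    intro i
    rw [hAdef, Finset.mem_filter]
    refine ⟨Finset.mem_univ _, ?_⟩
    have h1 := hh.trans (Finset.inf'_le _ (Finset.mem_univ i))
    have h2 : slimSketch h L i (h i e) ≤ L.count e + collNum L e (h i) := by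
      have h3 := slimProcessAux_le h i (h i e) L (fun _ => 0) (fun _ _ => 0)
      have h4 := countP_le_collNum L e (h i)
      unfold slimSketch
      omega
    have h5 : (slimSketch h L i (h i e) : ℝ) ≤ L.count e + collNum L e (h i) := by
      exact_mod_cast h2
    linarith
  · rw [PMF.toMeasure_uniformOfFintype_apply _ (Set.toFinite _).measurableSet]
    have hc : (0 : ℝ) < (Fintype.card (ι → Fin w) : ℝ) := by
      exact_mod_cast Fintype.card_pos
    have hcard : Fintype.card (Fin d → ι → Fin w) = Fintype.card (ι → Fin w) ^ d := by
      rw [Fintype.card_fun, Fintype.card_fin]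
    have hpi : Fintype.card ((Fintype.piFinset (fun _ : Fin d => A) : Finset _) :
        Set (Fin d → ι → Fin w)) = A.card ^ d := by
      rw [← Set.toFinset_card, Finset.toFinset_coe, Fintype.card_piFinset_const]
    simp only [hcard, hpi]
    rw [← ENNReal.ofReal_natCast, ← ENNReal.ofReal_natCast,
      ← ENNReal.ofReal_div_of_pos (by push_cast; positivity)]
    apply ENNReal.ofReal_le_ofReal
    push_cast
    have he : Real.exp (-(d : ℝ)) = Real.exp (-1) ^ d := by
      rw [← Real.exp_nat_mul]; congr 1; ring
    rw [he, div_le_iff₀ (by positivity), ← mul_pow]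
    exact pow_le_pow_left₀ (Nat.cast_nonneg _) hA d
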